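/- In the q-shuffle algebra V on letters x, y, for all natural numbers i, j the doubly alternating words (xxyy)^i and (xxyy)^j commute under the q-shuffle product: (xxyy)^i ⋆ (xxyy)^j = (xxyy)^j ⋆ (xxyy)^i, where powers are concatenation powers. -/

import Mathlib

noncomputable section

/-- The letter `x`. -/
def bX : Bool := false
/-- The letter `y`. -/
def bY : Bool := true

/-- The bilinear pairing on letters: `⟨x,x⟩ = ⟨y,y⟩ = 2`, `⟨x,y⟩ = ⟨y,x⟩ = -2`. -/
def qbr (a b : Bool) : ℤ := if a = b then 2 else -2

/-- The sum `⟨a, w₁⟩ + ⋯ + ⟨a, wₙ⟩` for a letter `a` and a word `w`. -/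
def qE (a : Bool) (w : List Bool) : ℤ := (w.map (qbr a)).sum

/-- Linear map on the free algebra (words-indexed finsupps) given by prepending a letter. -/
def qcons (F : Type*) [Field F] (a : Bool) :
    (List Bool →₀ F) →ₗ[F] (List Bool →₀ F) :=
  Finsupp.lmapDomain F F (List.cons a)

/-- The q-shuffle product of two words, as an element of the free algebra `List Bool →₀ F`.
Defined by the recursion `u ⋆ v = u₁((u₂⋯u_r) ⋆ v) + q^{⟨v₁,u₁⟩+⋯+⟨v₁,u_r⟩} v₁(u ⋆ (v₂⋯v_s))`. -/
def qsh {F : Type*} [Field F] (q : F) : List Bool → List Bool → (List Bool →₀ F)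
  | [], v => Finsupp.single v 1
  | a :: u, [] => Finsupp.single (a :: u) 1
  | a :: u, b :: v =>
      qcons F a (qsh q u (b :: v)) +
        (q ^ (qbr b a + qE b u)) • qcons F b (qsh q (a :: u) v)
  termination_by u v => u.length + v.length
  decreasing_by all_goals (simp only [List.length_cons]; omega)

/-- Concatenation power of a word. -/
def wpow (w : List Bool) : ℕ → List Bool
  | 0 => []
  | n + 1 => w ++ wpow w n

def wXXYY : List Bool := [bX, bX, bY, bY]
def wYYXX : List Bool := [bY, bY, bX, bX]
def wXY : List Bool := [bX, bY]
def wYX : List Bool := [bY, bX]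


section Aux
variable {F : Type*} [Field F]

abbrev VV (F : Type*) [Field F] := List Bool →₀ F

def qM (q : F) : VV F →ₗ[F] VV F →ₗ[F] VV F :=
  Finsupp.linearCombination F (fun u => Finsupp.linearCombination F (qsh q u))

def qK (q : F) (b : Bool) : VV F →ₗ[F] VV F :=
  Finsupp.linearCombination F (fun u => Finsupp.single u (q ^ qE b u))

abbrev wd (F : Type*) [Field F] (w : List Bool) : VV F := Finsupp.single w 1

lemma qM_wd (q : F) (u v : List Bool) : qM q (wd F u) (wd F v) = qsh q u v := by
  simp [qM, wd]

lemma qK_wd (q : F) (b : Bool) (u : List Bool) :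
    qK q b (wd F u) = (q ^ qE b u) • wd F u := by
  simp [qK, wd]

lemma qcons_wd (b : Bool) (u : List Bool) : qcons F b (wd F u) = wd F (b :: u) := by
  simp [qcons, wd]

lemma ext1 {W : Type*} [AddCommGroup W] [Module F W] {f g : VV F →ₗ[F] W}
    (h : ∀ u, f (wd F u) = g (wd F u)) (U : VV F) : f U = g U := by
  have : f = g := by
    apply Finsupp.lhom_ext'
    intro u
    apply LinearMap.ext_ring
    exact h u
  rw [this]

lemma qsh_nil_right (q : F) (u : List Bool) : qsh q u [] = wd F u := by
  cases u <;> simp [qsh, wd]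

lemma qsh_nil_left (q : F) (u : List Bool) : qsh q [] u = wd F u := by
  cases u <;> simp [qsh, wd]

lemma qE_cons (b a : Bool) (u : List Bool) : qE b (a :: u) = qbr b a + qE b u := by
  simp [qE]

lemma qsh_cc (q : F) (a b : Bool) (u v : List Bool) :
    qsh q (a :: u) (b :: v) = qcons F a (qsh q u (b :: v)) +
      (q ^ (qE b (a :: u))) • qcons F b (qsh q (a :: u) v) := by
  rw [qsh, qE_cons]

lemma qM_one_left (q : F) (V : VV F) : qM q (wd F []) V = V := by
  refine ext1 (f := qM q (wd F [])) (g := LinearMap.id) ?_ V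
  intro u
  simp only [qM_wd, qsh_nil_left, LinearMap.id_coe, id_eq]

lemma qM_one_right (q : F) (V : VV F) : qM q V (wd F []) = V := by
  refine ext1 (f := (qM q).flip (wd F [])) (g := LinearMap.id) ?_ V
  intro u
  simp only [LinearMap.flip_apply, qM_wd, qsh_nil_right, LinearMap.id_coe, id_eq]

lemma qM_cc (q : F) (a b : Bool) (U V : VV F) :
    qM q (qcons F a U) (qcons F b V) = qcons F a (qM q U (qcons F b V)) +
      qcons F b (qM q (qK q b (qcons F a U)) V) := by
  have h1 : ∀ u, qM q (qcons F a (wd F u)) (qcons F b V)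
      = qcons F a (qM q (wd F u) (qcons F b V)) +
      qcons F b (qM q (qK q b (qcons F a (wd F u))) V) := by
    intro u
    refine ext1 (f := (qM q (qcons F a (wd F u))) ∘ₗ (qcons F b))
      (g := (qcons F a) ∘ₗ (qM q (wd F u)) ∘ₗ (qcons F b) +
        (qcons F b) ∘ₗ (qM q (qK q b (qcons F a (wd F u))))) ?_ V
    intro v
    simp only [LinearMap.comp_apply, LinearMap.add_apply, qcons_wd, qM_wd, qK_wd, map_smul,
      LinearMap.smul_apply, qsh_cc]
  refine ext1 (f := ((qM q).flip (qcons F b V)) ∘ₗ (qcons F a))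
      (g := (qcons F a) ∘ₗ ((qM q).flip (qcons F b V)) +
        (qcons F b) ∘ₗ ((qM q).flip V) ∘ₗ (qK q b) ∘ₗ (qcons F a)) ?_ U
  intro u
  simpa only [LinearMap.comp_apply, LinearMap.add_apply, LinearMap.flip_apply] using h1 u

lemma qK_cons (q : F) (hq : q ≠ 0) (b a : Bool) (U : VV F) :
    qK q b (qcons F a U) = (q ^ qbr b a) • qcons F a (qK q b U) := by
  refine ext1 (f := (qK q b) ∘ₗ (qcons F a))
    (g := (q ^ qbr b a) • ((qcons F a) ∘ₗ (qK q b))) ?_ U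
  intro u
  simp only [LinearMap.comp_apply, LinearMap.smul_apply, qcons_wd, qK_wd, map_smul, qE_cons,
    zpow_add₀ hq, smul_smul]

lemma qK_qsh (q : F) (hq : q ≠ 0) (c : Bool) : ∀ (n : ℕ) (u v : List Bool),
    u.length + v.length ≤ n → qK q c (qsh q u v) = (q ^ (qE c u + qE c v)) • qsh q u v := by
  intro n
  induction n with
  | zero =>
    intro u v h
    have hu : u = [] := List.length_eq_zero_iff.mp (by omega)
    have hv : v = [] := List.length_eq_zero_iff.mp (by omega)
    subst hu hv
    simp only [qsh_nil_left, qK_wd, qE, List.map_nil, List.sum_nil, add_zero]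
  | succ n ih =>
    intro u v h
    rcases u with _ | ⟨a, u⟩
    · simp [qsh_nil_left, qK_wd, qE]
    rcases v with _ | ⟨b, v⟩
    · simp [qsh_nil_right, qK_wd, qE]
    simp only [List.length_cons] at h
    rw [qsh_cc, map_add, map_smul, qK_cons q hq, qK_cons q hq,
      ih u (b :: v) (by simp only [List.length_cons]; omega),
      ih (a :: u) v (by simp only [List.length_cons]; omega)]
    simp only [map_smul, smul_add, smul_smul, ← zpow_add₀ hq]
    simp only [qE_cons]
    congr 3 <;> ring

lemma assoc_wd (q : F) (hq : q ≠ 0) : ∀ (n : ℕ) (u v w : List Bool),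
    u.length + v.length + w.length ≤ n →
    qM q (qM q (wd F u) (wd F v)) (wd F w) = qM q (wd F u) (qM q (wd F v) (wd F w)) := by
  intro n
  induction n with
  | zero =>
    intro u v w h
    have hu : u = [] := List.length_eq_zero_iff.mp (by omega)
    subst hu
    simp only [qM_one_left]
  | succ n ih =>
    intro u v w h
    rcases u with _ | ⟨a, u⟩
    · simp only [qM_one_left]
    rcases v with _ | ⟨b, v⟩
    · simp only [qM_one_left, qM_one_right]
    rcases w with _ | ⟨c, w⟩
    · simp only [qM_one_right]
    simp only [List.length_cons] at h
    have i1 := ih u (b :: v) (c :: w) (by simp only [List.length_cons]; omega)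
    have i2 := ih (a :: u) v (c :: w) (by simp only [List.length_cons]; omega)
    have i3 := ih (a :: u) (b :: v) w (by simp only [List.length_cons]; omega)
    have e1 : qM q (wd F (a :: u)) (wd F (b :: v))
        = qcons F a (qM q (wd F u) (wd F (b :: v))) +
          (q ^ qE b (a :: u)) • qcons F b (qM q (wd F (a :: u)) (wd F v)) := by
      simp only [qM_wd, qsh_cc]
    have e2 : qM q (wd F (b :: v)) (wd F (c :: w))
        = qcons F b (qM q (wd F v) (wd F (c :: w))) +
          (q ^ qE c (b :: v)) • qcons F c (qM q (wd F (b :: v)) (wd F w)) := by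
      simp only [qM_wd, qsh_cc]
    have ek : qK q c (qM q (wd F (a :: u)) (wd F (b :: v))) =
        (q ^ (qE c (a :: u) + qE c (b :: v))) • qM q (wd F (a :: u)) (wd F (b :: v)) := by
      simp only [qM_wd]
      exact qK_qsh q hq c _ _ _ le_rfl
    have L : qM q (qM q (wd F (a :: u)) (wd F (b :: v))) (wd F (c :: w)) =
        qcons F a (qM q (qM q (wd F u) (wd F (b :: v))) (wd F (c :: w))) +
        (q ^ qE b (a :: u)) • qcons F b (qM q (qM q (wd F (a :: u)) (wd F v)) (wd F (c :: w))) +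
        qcons F c (qM q (qK q c (qM q (wd F (a :: u)) (wd F (b :: v)))) (wd F w)) := by
      rw [e1]
      simp only [map_add, map_smul, LinearMap.add_apply, LinearMap.smul_apply]
      rw [← qcons_wd c w, qM_cc, qM_cc]
      simp only [smul_add]
      abel
    have R : qM q (wd F (a :: u)) (qM q (wd F (b :: v)) (wd F (c :: w))) =
        qcons F a (qM q (wd F u) (qM q (wd F (b :: v)) (wd F (c :: w)))) +
        (q ^ qE b (a :: u)) • qcons F b (qM q (wd F (a :: u)) (qM q (wd F v) (wd F (c :: w)))) +
        (q ^ qE c (b :: v)) • (q ^ qE c (a :: u)) •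
          qcons F c (qM q (wd F (a :: u)) (qM q (wd F (b :: v)) (wd F w))) := by
      rw [e2]
      simp only [map_add, map_smul]
      rw [← qcons_wd a u, qM_cc, qM_cc, qcons_wd, qK_wd, qK_wd]
      simp only [map_smul, smul_add, LinearMap.smul_apply]
      abel
    rw [L, R, i1, i2, ek]
    simp only [map_smul, LinearMap.smul_apply]
    rw [i3, smul_smul, ← zpow_add₀ hq, add_comm (qE c (a :: u))]

lemma qM_assoc (q : F) (hq : q ≠ 0) (U V W : VV F) :
    qM q (qM q U V) W = qM q U (qM q V W) := by
  have h1 : ∀ u v, qM q (qM q (wd F u) (wd F v)) W = qM q (wd F u) (qM q (wd F v) W) := by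
    intro u v
    refine ext1 (f := qM q (qM q (wd F u) (wd F v)))
      (g := (qM q (wd F u)) ∘ₗ (qM q (wd F v))) ?_ W
    intro w
    exact assoc_wd q hq _ _ _ _ le_rfl
  have h2 : ∀ u, qM q (qM q (wd F u) V) W = qM q (wd F u) (qM q V W) := by
    intro u
    refine ext1 (f := (qM q).flip W ∘ₗ (qM q (wd F u)))
      (g := (qM q (wd F u)) ∘ₗ (qM q).flip W) ?_ V
    intro v
    exact h1 u v
  refine ext1 (f := (qM q).flip W ∘ₗ (qM q).flip V)
      (g := (qM q).flip (qM q V W)) ?_ U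
  intro u
  exact h2 u

/-- Alternating words. -/
def wA (n : ℕ) : List Bool := wpow wXY n
def wB (n : ℕ) : List Bool := bY :: wA n

lemma wA_zero : wA 0 = [] := rfl
lemma wA_succ (n : ℕ) : wA (n + 1) = bX :: wB n := rfl
lemma wB_eq (n : ℕ) : wB n = bY :: wA n := rfl

lemma qE_wA (b : Bool) (n : ℕ) : qE b (wA n) = 0 := by
  induction n with
  | zero => rfl
  | succ n ih =>
    rw [wA_succ, wB, qE_cons, qE_cons, ih]
    cases b <;> simp [qbr, bX, bY]

lemma qE_X_wB (n : ℕ) : qE bX (wB n) = -2 := by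
  rw [wB, qE_cons, qE_wA]; simp [qbr, bX, bY]

lemma qE_Y_wB (n : ℕ) : qE bY (wB n) = 2 := by
  rw [wB, qE_cons, qE_wA]; simp [qbr, bY]

def sP (f : ℕ → ℕ → VV F) : ℕ → ℕ → VV F
  | 0, _ => 0
  | a + 1, b => f a b
def sQ (f : ℕ → ℕ → VV F) : ℕ → ℕ → VV F
  | _, 0 => 0
  | a, b + 1 => f a b

def AA (q : F) (a b : ℕ) : VV F := qsh q (wA a) (wA b)
def AB (q : F) (a b : ℕ) : VV F := qsh q (wA a) (wB b)
def BA (q : F) (a b : ℕ) : VV F := qsh q (wB a) (wA b)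
def BB (q : F) (a b : ℕ) : VV F := qsh q (wB a) (wB b)

lemma AA00 (q : F) : AA q 0 0 = wd F [] := by
  simp only [AA, wA_zero, qsh_nil_left]

lemma BA_rec (q : F) (a b : ℕ) : BA q a b = qcons F bY (AA q a b) +
    (q ^ (-2 : ℤ)) • qcons F bX (sQ (BB q) a b) := by
  rcases b with _ | b
  · simp only [BA, AA, wA_zero, qsh_nil_right, qcons_wd, sQ, map_zero, smul_zero, add_zero, wB]
  · simp only [BA, AA, BB, sQ, wA_succ]
    conv_lhs => rw [wB_eq a, qsh_cc, ← wB_eq a, qE_X_wB]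

lemma AB_rec (q : F) (a b : ℕ) : AB q a b = qcons F bX (sP (BB q) a b) +
    qcons F bY (AA q a b) := by
  rcases a with _ | a
  · simp only [AB, AA, wA_zero, qsh_nil_left, qcons_wd, sP, map_zero, zero_add, wB]
  · simp only [AB, AA, BB, sP]
    conv_lhs => rw [wA_succ, wB_eq b, qsh_cc, ← wB_eq b, ← wA_succ, qE_wA, zpow_zero, one_smul]

lemma BB_rec0 (q : F) (a b : ℕ) : BB q a b = qcons F bY (AB q a b) +
    (q ^ (2 : ℤ)) • qcons F bY (BA q a b) := by
  simp only [AB, BA, BB]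
  conv_lhs => rw [wB_eq a, wB_eq b, qsh_cc, ← wB_eq a, ← wB_eq b, qE_Y_wB]

lemma BB_rec (q : F) (hq : q ≠ 0) (a b : ℕ) : BB q a b =
    (1 + q ^ (2 : ℤ)) • qcons F bY (qcons F bY (AA q a b)) +
    qcons F bY (qcons F bX (sP (BB q) a b + sQ (BB q) a b)) := by
  rw [BB_rec0, AB_rec, BA_rec]
  simp only [map_add, map_smul, smul_add, smul_smul, ← zpow_add₀ hq]
  norm_num
  module

lemma AA_rec (q : F) (a b : ℕ) : AA q a b = (if a = 0 ∧ b = 0 then wd F [] else 0) +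
    qcons F bX (qcons F bY (sP (AA q) a b + sQ (AA q) a b)) +
    (1 + q ^ (-2 : ℤ)) • qcons F bX (qcons F bX (sP (sQ (BB q)) a b)) := by
  rcases a with _ | a
  · rcases b with _ | b
    · simp [AA00, sP, sQ]
    · simp only [sP, sQ, AA, wA_zero, qsh_nil_left, wA_succ, wB]
      simp [qcons_wd]
  · rcases b with _ | b
    · simp only [sP, sQ, AA, wA_zero, qsh_nil_right, wA_succ, wB]
      simp [qcons_wd]
    · have : AA q (a+1) (b+1) = qcons F bX (BA q a (b+1)) + qcons F bX (AB q (a+1) b) := by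
        simp only [AB, BA, AA]
        conv_lhs => rw [wA_succ, wA_succ, qsh_cc, ← wA_succ, ← wA_succ, qE_wA, zpow_zero, one_smul]
      rw [this, BA_rec, AB_rec]
      simp only [sP, sQ, map_add, map_smul]
      simp
      module

lemma comm_AB (q : F) (hq : q ≠ 0) : ∀ n : ℕ, ∀ a b : ℕ, a + b ≤ n →
    AA q a b = AA q b a ∧ BB q a b = BB q b a := by
  have swapP : ∀ (f : ℕ → ℕ → VV F) (n a b : ℕ), a + b ≤ n + 1 →
      (∀ a b, a + b ≤ n → f a b = f b a) → sP f a b = sQ f b a := by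
    intro f n a b h hf
    rcases a with _ | a
    · simp [sP, sQ]
    · simp only [sP, sQ]; exact hf _ _ (by omega)
  intro n
  induction n with
  | zero =>
    intro a b h
    obtain rfl : a = 0 := by omega
    obtain rfl : b = 0 := by omega
    exact ⟨rfl, rfl⟩
  | succ n ih =>
    intro a b h
    have hA : AA q a b = AA q b a := by
      rw [AA_rec q a b, AA_rec q b a, swapP (AA q) n a b h (fun a b h => (ih a b h).1),
        ← swapP (AA q) n b a (by omega) (fun a b h => (ih a b h).1), add_comm (sQ _ _ _)]
      have : sP (sQ (BB q)) a b = sP (sQ (BB q)) b a := by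
        rcases a with _ | a <;> rcases b with _ | b <;> simp only [sP, sQ]
        exact (ih _ _ (by omega)).2
      rw [this]
      simp only [and_comm]
    refine ⟨hA, ?_⟩
    rw [BB_rec q hq a b, BB_rec q hq b a, hA,
      swapP (BB q) n a b h (fun a b h => (ih a b h).2),
        ← swapP (BB q) n b a (by omega) (fun a b h => (ih a b h).2), add_comm (sQ _ _ _)]

def altS (f : ℕ → ℕ → VV F) (n : ℕ) : VV F :=
  ∑ p ∈ Finset.HasAntidiagonal.antidiagonal n, ((-1 : F) ^ p.1) • f p.1 p.2

lemma altS_sP (f : ℕ → ℕ → VV F) (n : ℕ) : altS (sP f) (n + 1) = - altS f n := by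
  simp only [altS, Finset.Nat.sum_antidiagonal_succ, sP, smul_zero, zero_add, pow_succ,
    mul_neg, mul_one, neg_smul, Finset.sum_neg_distrib]

lemma altS_sQ (f : ℕ → ℕ → VV F) (n : ℕ) : altS (sQ f) (n + 1) = altS f n := by
  simp only [altS, Finset.Nat.sum_antidiagonal_succ', sQ, smul_zero, add_zero, zero_add]

lemma altS_PQ (f : ℕ → ℕ → VV F) (n : ℕ) : altS (sP f) n + altS (sQ f) n = 0 := by
  rcases n with _ | n
  · simp [altS, sP, sQ]
  · rw [altS_sP, altS_sQ]; simp

lemma altS_add (f g : ℕ → ℕ → VV F) (n : ℕ) :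
    altS (fun a b => f a b + g a b) n = altS f n + altS g n := by
  simp only [altS, smul_add, Finset.sum_add_distrib]

lemma altS_map (L : VV F →ₗ[F] VV F) (f : ℕ → ℕ → VV F) (n : ℕ) :
    altS (fun a b => L (f a b)) n = L (altS f n) := by
  simp only [altS, map_sum, map_smul]

lemma altS_BB (q : F) (hq : q ≠ 0) (n : ℕ) : altS (BB q) n =
    (1 + q ^ (2 : ℤ)) • qcons F bY (qcons F bY (altS (AA q) n)) := by
  have e : BB q = fun a b => ((1 + q ^ (2 : ℤ)) • (qcons F bY ∘ₗ qcons F bY)) (AA q a b) +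
      (qcons F bY ∘ₗ qcons F bX) (sP (BB q) a b + sQ (BB q) a b) := by
    funext a b
    rw [BB_rec q hq a b]; rfl
  conv_lhs => rw [e]
  rw [altS_add, altS_map, altS_map, altS_add, altS_PQ, map_zero, add_zero]
  rfl

lemma altS_AA (q : F) (hq : q ≠ 0) (n : ℕ) : altS (AA q) (n + 2) =
    (-((1 + q ^ (-2 : ℤ)) * (1 + q ^ (2 : ℤ)))) •
      qcons F bX (qcons F bX (qcons F bY (qcons F bY (altS (AA q) n)))) := by
  have e : AA q = fun a b => ((if a = 0 ∧ b = 0 then wd F [] else 0) +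
      (qcons F bX ∘ₗ qcons F bY) (sP (AA q) a b + sQ (AA q) a b)) +
      ((1 + q ^ (-2 : ℤ)) • (qcons F bX ∘ₗ qcons F bX)) (sP (sQ (BB q)) a b) := by
    funext a b
    rw [AA_rec q a b]; rfl
  have z : altS (fun a b => if a = 0 ∧ b = 0 then wd F [] else 0) (n + 2) = 0 := by
    apply Finset.sum_eq_zero
    intro p hp
    rw [Finset.HasAntidiagonal.mem_antidiagonal] at hp
    beta_reduce
    rw [if_neg (by omega), smul_zero]
  conv_lhs => rw [e]
  rw [altS_add, altS_add, altS_map, altS_map, altS_add, altS_PQ, map_zero, add_zero, z, zero_add,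
    altS_sP, altS_sQ, altS_BB q hq]
  simp only [LinearMap.smul_apply, LinearMap.comp_apply, map_neg, map_smul, smul_smul,
    neg_smul]
  rw [mul_comm (1 + q ^ (2 : ℤ))]

lemma altS_eq (q : F) (hq : q ≠ 0) (n : ℕ) : altS (AA q) (2 * n) =
    ((-((1 + q ^ (-2 : ℤ)) * (1 + q ^ (2 : ℤ)))) ^ n) • wd F (wpow wXXYY n) := by
  induction n with
  | zero => simp [altS, AA00, wpow]
  | succ n ih =>
    rw [show 2 * (n + 1) = 2 * n + 2 by ring, altS_AA q hq, ih]
    simp only [map_smul, qcons_wd, smul_smul, pow_succ']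
    rfl

lemma comm_mul (q : F) (hq : q ≠ 0) {X Y Z : VV F} (h1 : qM q X Z = qM q Z X)
    (h2 : qM q Y Z = qM q Z Y) : qM q (qM q X Y) Z = qM q Z (qM q X Y) := by
  rw [qM_assoc q hq, h2, ← qM_assoc q hq, h1, qM_assoc q hq]

lemma comm_altS (q : F) (hq : q ≠ 0) {Z : VV F}
    (h : ∀ a, qM q (wd F (wA a)) Z = qM q Z (wd F (wA a))) (n : ℕ) :
    qM q (altS (AA q) n) Z = qM q Z (altS (AA q) n) := by
  simp only [altS, map_sum, map_smul, LinearMap.sum_apply, LinearMap.smul_apply]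
  refine Finset.sum_congr rfl fun p _ => ?_
  rw [AA, ← qM_wd, comm_mul q hq (h _) (h _)]

end Aux

/-- The doubly alternating words `(xxyy)^i` and `(xxyy)^j` commute under the q-shuffle product. -/
theorem stmt16 {F : Type*} [Field F] [CharZero F] (q : F) (hq : q ≠ 0)
    (hq1 : ∀ m : ℕ, 0 < m → q ^ m ≠ 1) (i j : ℕ) :
    qsh q (wpow wXXYY i) (wpow wXXYY j) = qsh q (wpow wXXYY j) (wpow wXXYY i) := by
  have hc : -((1 + q ^ (-2 : ℤ)) * (1 + q ^ (2 : ℤ))) ≠ 0 := by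
    have h2 : (1 + q ^ 2) ≠ 0 := by
      intro h
      apply hq1 4 (by norm_num)
      linear_combination (q ^ 2 - 1) * h
    have h3 : 1 + q ^ (-2 : ℤ) = (1 + q ^ 2) / q ^ 2 := by
      rw [zpow_neg, zpow_ofNat]
      field_simp
      ring
    rw [h3, zpow_ofNat]
    exact neg_ne_zero.mpr (mul_ne_zero (div_ne_zero h2 (pow_ne_zero _ hq)) h2)
  have hw : ∀ n, wd F (wpow wXXYY n) =
      ((-((1 + q ^ (-2 : ℤ)) * (1 + q ^ (2 : ℤ)))) ^ n)⁻¹ • altS (AA q) (2 * n) := by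
    intro n
    rw [altS_eq q hq, smul_smul, inv_mul_cancel₀ (pow_ne_zero _ hc), one_smul]
  have hA : ∀ a b, qM q (wd F (wA a)) (wd F (wA b)) = qM q (wd F (wA b)) (wd F (wA a)) := by
    intro a b
    rw [qM_wd, qM_wd]
    exact (comm_AB q hq _ a b le_rfl).1
  have hS : ∀ m n, qM q (altS (AA q) m) (altS (AA q) n) =
      qM q (altS (AA q) n) (altS (AA q) m) := fun m n =>
    comm_altS q hq (fun a => (comm_altS q hq (fun b => hA b a) n).symm) m
  rw [← qM_wd, ← qM_wd, hw i, hw j]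
  simp only [map_smul, LinearMap.smul_apply]
  rw [hS, smul_comm]
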